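/- arXiv:2309.06338 — 3 statements merged into one kernel-verified Lean document; each statement's English description precedes it below -/
import Mathlib

section
/- Let T be a finite tree whose diameter is odd and which has a unique diametrical pair, i.e., there is exactly one unordered pair {a, b} of vertices with d(a,b) equal to the diameter of T. Then the eccentric graph E(T) is acyclic (its girth is ∞). -/
open SimpleGraph

/-- The eccentricity of a vertex `v`: the max distance from `v` to any vertex. -/
noncomputable def ecc {V : Type*} [Fintype V] (G : SimpleGraph V) (v : V) : ℕ :=
  Finset.univ.sup fun u => G.dist v u

/-- `u` is eccentric to `v` in `G` if `d(v,u) = e(v)`. -/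
def IsEccentric {V : Type*} [Fintype V] (G : SimpleGraph V) (v u : V) : Prop :=
  G.dist v u = ecc G v

/-- The eccentric graph of `G`: distinct `u, v` adjacent iff one is eccentric to the other. -/
noncomputable def eccGraph {V : Type*} [Fintype V] (G : SimpleGraph V) : SimpleGraph V :=
  SimpleGraph.fromRel fun u v => IsEccentric G u v

/-- The diameter of `G`: the maximum eccentricity. -/
noncomputable def gdiam {V : Type*} [Fintype V] (G : SimpleGraph V) : ℕ :=
  Finset.univ.sup fun v => ecc G v
namespace SimpleGraph

variable {V : Type*} {G : SimpleGraph V}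

/-- A vertex on a shortest walk splits the distance between its endpoints. -/
lemma Connected.dist_add_dist_of_mem_support {a b m : V} (hG : G.Connected) {p : G.Walk a b}
    (hp : p.length = G.dist a b) (hm : m ∈ p.support) :
    G.dist a m + G.dist m b = G.dist a b := by
  classical
  have h1 := dist_le (p.takeUntil m hm)
  have h2 := dist_le (p.dropUntil m hm)
  have h3 := congrArg Walk.length (p.take_spec hm)
  rw [Walk.length_append] at h3
  have h4 := hG.dist_triangle (u := a) (v := m) (w := b)
  omega

/-- In a tree, a vertex between `a` and `b` lies between `a` and `u` or between `u` and `b`. -/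
lemma IsTree.dist_add_dist_or {a b m : V} (hG : G.IsTree)
    (hm : G.dist a m + G.dist m b = G.dist a b) (u : V) :
    G.dist a m + G.dist m u = G.dist a u ∨ G.dist u m + G.dist m b = G.dist u b := by
  classical
  obtain ⟨p, hp⟩ := hG.connected.exists_walk_length_eq_dist a m
  obtain ⟨q, hq⟩ := hG.connected.exists_walk_length_eq_dist m b
  obtain ⟨r, hr⟩ := hG.connected.exists_walk_length_eq_dist a u
  obtain ⟨s, hs⟩ := hG.connected.exists_walk_length_eq_dist u b
  have hpq : (p.append q).IsPath :=
    Walk.isPath_of_length_eq_dist _ (by rw [Walk.length_append, hp, hq, hm])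
  have heq : p.append q = (r.append s).bypass :=
    (hG.existsUnique_path a b).unique hpq (Walk.bypass_isPath _)
  have hmem : m ∈ (r.append s).support := by
    apply Walk.support_bypass_subset_support
    rw [← heq, Walk.mem_support_append_iff]
    exact Or.inl p.end_mem_support
  rcases (Walk.mem_support_append_iff _ _).1 hmem with h | h
  · exact Or.inl (hG.connected.dist_add_dist_of_mem_support hr h)
  · exact Or.inr (hG.connected.dist_add_dist_of_mem_support hs h)

/-- Any three vertices of a tree have a median. -/
lemma IsTree.exists_median (hG : G.IsTree) (a b v : V) :
    ∃ m, G.dist a m + G.dist m b = G.dist a b ∧ G.dist a m + G.dist m v = G.dist a v ∧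
      G.dist v m + G.dist m b = G.dist v b := by
  suffices H : ∀ n m, G.dist m b = n → G.dist a m + G.dist m b = G.dist a b →
      G.dist a m + G.dist m v = G.dist a v → ∃ m, G.dist a m + G.dist m b = G.dist a b ∧
        G.dist a m + G.dist m v = G.dist a v ∧ G.dist v m + G.dist m b = G.dist v b from
    H _ a rfl (by simp) (by simp)
  intro n
  induction n with
  | zero =>
    intro m hn h1 h2
    obtain rfl := hG.connected.dist_eq_zero_iff.1 hn
    exact ⟨m, h1, h2, by simp⟩
  | succ n ih =>
    intro m hn h1 h2
    obtain ⟨p, hp⟩ := hG.connected.exists_walk_length_eq_dist m b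
    cases p with
    | nil => simp at hn
    | @cons _ m' _ hadj p =>
      have h3 := dist_le p
      rw [Walk.length_cons] at hp
      have h4 := hG.connected.dist_triangle (u := a) (v := m') (w := b)
      have h5 := hG.connected.dist_triangle (u := a) (v := m) (w := m')
      have h6 := hG.connected.dist_triangle (u := m) (v := m') (w := b)
      have h7 := dist_eq_one_iff_adj.2 hadj
      have hm' : G.dist a m' + G.dist m' b = G.dist a b := by omega
      by_cases hv : G.dist a m' + G.dist m' v = G.dist a v
      · exact ih m' (by omega) hm' hv
      · have h8 := (hG.dist_add_dist_or hm' v).resolve_left hv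
        refine ⟨m, h1, h2, ?_⟩
        have h9 := hG.dist_eq_dist_add_one_of_adj v hadj
        rw [G.dist_comm (u := m) (v := v)] at h2
        rw [G.dist_comm (u := m') (v := v)] at hv
        omega

/-- The four-point condition for trees. -/
lemma IsTree.four_point (hG : G.IsTree) (a b u v : V) :
    G.dist v u + G.dist a b ≤
      max (G.dist v b + G.dist a u) (G.dist v a + G.dist u b) := by
  obtain ⟨m, h1, h2, h3⟩ := hG.exists_median a b v
  have h4 := hG.connected.dist_triangle (u := v) (v := m) (w := u)
  have h5 := G.dist_comm (u := m) (v := v)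
  have h6 := G.dist_comm (u := m) (v := u)
  have h7 := G.dist_comm (u := a) (v := v)
  rcases hG.dist_add_dist_or h1 u with h | h <;> omega

/-- In a tree, the perimeter of a triangle is even. -/
lemma IsTree.even_dist_add_dist_add_dist (hG : G.IsTree) (a b v : V) :
    Even (G.dist v a + G.dist v b + G.dist a b) := by
  obtain ⟨m, h1, h2, h3⟩ := hG.exists_median a b v
  have h5 := G.dist_comm (u := m) (v := v)
  have h7 := G.dist_comm (u := a) (v := v)
  exact ⟨G.dist a m + G.dist m b + G.dist v m, by omega⟩

/-- Every vertex of a cycle has two distinct neighbours on that cycle. -/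
lemma Walk.IsCycle.exists_ne_adj_of_mem_support {x v : V} {c : G.Walk x x} (hc : c.IsCycle)
    (hv : v ∈ c.support) :
    ∃ p ∈ c.support, ∃ q ∈ c.support, p ≠ q ∧ G.Adj v p ∧ G.Adj v q := by
  classical
  have hr := hc.rotate hv
  have hs : ∀ y ∈ (c.rotate v hv).support, y ∈ c.support := fun y hy ↦
    (Walk.mem_support_rotate_iff ..).1 hy
  exact ⟨_, hs _ (Walk.getVert_mem_support _ _), _, hs _ (Walk.getVert_mem_support _ _),
    hr.snd_ne_penultimate, Walk.adj_snd hr.not_nil, (Walk.adj_penultimate hr.not_nil).symm⟩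

/-- A graph in which all vertices outside `{a, b}` have at most one neighbour is acyclic. -/
lemma isAcyclic_of_subsingleton_neighborSet {a b : V}
    (h : ∀ v, v ≠ a → v ≠ b → (G.neighborSet v).Subsingleton) : G.IsAcyclic := by
  intro x c hc
  have key : ∀ v ∈ c.support, v = a ∨ v = b := by
    intro v hv
    by_contra! hne
    obtain ⟨p, -, q, -, hpq, hp, hq⟩ := hc.exists_ne_adj_of_mem_support hv
    exact hpq (h v hne.1 hne.2 hp hq)
  obtain ⟨p, hp, q, hq, hpq, hxp, hxq⟩ := hc.exists_ne_adj_of_mem_support c.start_mem_support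
  have := hxp.ne
  have := hxq.ne
  have := key x c.start_mem_support
  have := key p hp
  have := key q hq
  grind

end SimpleGraph

lemma dist_le_ecc {V : Type*} [Fintype V] (G : SimpleGraph V) (v u : V) :
    G.dist v u ≤ ecc G v :=
  Finset.le_sup (f := fun u ↦ G.dist v u) (Finset.mem_univ u)

lemma dist_le_gdiam {V : Type*} [Fintype V] (G : SimpleGraph V) (v u : V) :
    G.dist v u ≤ gdiam G :=
  (dist_le_ecc G v u).trans (Finset.le_sup (f := fun v ↦ ecc G v) (Finset.mem_univ v))

/-- In a tree with a unique diametrical pair, all eccentric vertices belong to that pair. -/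
lemma IsEccentric.eq_or_eq {V : Type*} [Fintype V] {T : SimpleGraph V} (hT : T.IsTree) {a b : V}
    (hab : T.dist a b = gdiam T)
    (huniq : ∀ a' b' : V, T.dist a' b' = gdiam T → s(a', b') = s(a, b))
    {v u : V} (hu : IsEccentric T v u) : u = a ∨ u = b := by
  by_contra! hne
  have h1 : T.dist a u ≠ gdiam T := fun h ↦ by
    have := huniq _ _ h
    grind
  have h2 : T.dist u b ≠ gdiam T := fun h ↦ by
    have := huniq _ _ h
    grind
  have h3 := hT.four_point a b u v
  have h4 := dist_le_ecc T v a
  have h5 := dist_le_ecc T v b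
  have h6 := dist_le_gdiam T a u
  have h7 := dist_le_gdiam T u b
  unfold IsEccentric at hu
  omega

/-- If a finite tree has odd diameter and a unique diametrical pair, its eccentric graph is
acyclic. -/
theorem stmt_2 {V : Type*} [Fintype V] (T : SimpleGraph V) (hT : T.IsTree)
    (hodd : Odd (gdiam T))
    (huniq : ∃ a b : V, T.dist a b = gdiam T ∧
      ∀ a' b' : V, T.dist a' b' = gdiam T → s(a', b') = s(a, b)) :
    (eccGraph T).IsAcyclic := by
  obtain ⟨a, b, hab, huniq⟩ := huniq
  have mem {v u : V} (hu : IsEccentric T v u) : u = a ∨ u = b := hu.eq_or_eq hT hab huniq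
  have not_both (v : V) (ha : IsEccentric T v a) (hb : IsEccentric T v b) : False := by
    have h := hT.even_dist_add_dist_add_dist a b v
    unfold IsEccentric at ha hb
    rw [ha, hb, hab] at h
    rw [← Nat.not_even_iff_odd] at hodd
    exact hodd (by simpa [Nat.even_add] using h)
  refine isAcyclic_of_subsingleton_neighborSet (a := a) (b := b) fun v hva hvb ↦ ?_
  have ecc_of_adj {p : V} (hp : (eccGraph T).Adj v p) : IsEccentric T v p := by
    rcases ((SimpleGraph.fromRel_adj _ _ _).1 hp).2 with h | h
    · exact h
    · exact ((mem h).elim hva hvb).elim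
  intro p hp q hq
  have hp := ecc_of_adj hp
  have hq := ecc_of_adj hq
  rcases mem hp with rfl | rfl <;> rcases mem hq with rfl | rfl
  · rfl
  · exact (not_both v hp hq).elim
  · exact (not_both v hq hp).elim
  · rfl
end

section
/- Let m, n ≥ 2 and consider the eccentric graph E(P_m □ P_n) of the grid graph. Then: (a) if m and n are both even, E(P_m □ P_n) is acyclic (girth ∞); (b) if m and n are both odd, the girth of E(P_m □ P_n) equals 3; (c) if m is even with m ≥ 4 and n is odd, the girth of E(P_m □ P_n) equals 4. -/
open SimpleGraph

theorem isEccentric_iff_forall_dist_le {V : Type*} [Fintype V] {G : SimpleGraph V} {v u : V} :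
    IsEccentric G v u ↔ ∀ w, G.dist v w ≤ G.dist v u := by
  unfold IsEccentric ecc
  refine ⟨fun h w => h ▸ Finset.le_sup (f := fun u => G.dist v u) (Finset.mem_univ w), fun h => ?_⟩
  exact le_antisymm (Finset.le_sup (f := fun u => G.dist v u) (Finset.mem_univ u))
    (Finset.sup_le fun w _ => h w)

theorem val_le_val_add_length_of_pathGraph_walk {n : ℕ} {u v : Fin n}
    (p : (pathGraph n).Walk u v) : v.val ≤ u.val + p.length ∧ u.val ≤ v.val + p.length := by
  induction p with
  | nil => simp
  | cons h p ih =>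
    rw [pathGraph_adj] at h
    rw [Walk.length_cons]
    omega

theorem exists_pathGraph_walk_length_eq_sub {n : ℕ} (k : ℕ) (u v : Fin n)
    (h : v.val = u.val + k) : ∃ p : (pathGraph n).Walk u v, p.length = k := by
  induction k generalizing u with
  | zero =>
    obtain rfl : v = u := Fin.ext h
    exact ⟨.nil, rfl⟩
  | succ k ih =>
    obtain ⟨p, hp⟩ := ih ⟨u.val + 1, by omega⟩ (by simp; omega)
    exact ⟨.cons (pathGraph_adj.2 (.inl rfl)) p, by simp [hp]⟩

theorem dist_pathGraph {n : ℕ} (u v : Fin n) :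
    (pathGraph n).dist u v = (u.val - v.val) + (v.val - u.val) := by
  wlog h : u ≤ v generalizing u v
  · rw [SimpleGraph.dist_comm, this v u (le_of_not_ge h), add_comm]
  have h' : u.val ≤ v.val := h
  obtain ⟨p, hp⟩ := exists_pathGraph_walk_length_eq_sub (v.val - u.val) u v (by omega)
  obtain ⟨q, hq⟩ := (pathGraph_preconnected n u v).exists_walk_length_eq_dist
  have := val_le_val_add_length_of_pathGraph_walk q
  have := SimpleGraph.dist_le p
  omega

theorem dist_boxProd_of_preconnected {V W : Type*} {G : SimpleGraph V} {H : SimpleGraph W}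
    (hG : G.Preconnected) (hH : H.Preconnected) (x y : V × W) :
    (G.boxProd H).dist x y = G.dist x.1 y.1 + H.dist x.2 y.2 := by
  have h := edist_boxProd (G := G) (H := H) x y
  rw [← (hG x.1 y.1).coe_dist_eq_edist, ← (hH x.2 y.2).coe_dist_eq_edist,
    ← (reachable_boxProd.2 ⟨hG x.1 y.1, hH x.2 y.2⟩).coe_dist_eq_edist] at h
  exact_mod_cast h

theorem isEccentric_boxProd {V W : Type*} [Fintype V] [Fintype W] {G : SimpleGraph V}
    {H : SimpleGraph W} (hG : G.Preconnected) (hH : H.Preconnected) (x y : V × W) :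
    IsEccentric (G.boxProd H) x y ↔ IsEccentric G x.1 y.1 ∧ IsEccentric H x.2 y.2 := by
  simp only [isEccentric_iff_forall_dist_le, dist_boxProd_of_preconnected hG hH]
  refine ⟨fun h => ⟨fun w => ?_, fun w => ?_⟩, fun h w => add_le_add (h.1 _) (h.2 _)⟩
  · simpa using h (w, y.2)
  · simpa using h (y.1, w)

theorem isEccentric_pathGraph {n : ℕ} (i j : Fin n) :
    IsEccentric (pathGraph n) i j ↔
      (j.val = 0 ∧ n ≤ 2 * i.val + 1) ∨ (j.val + 1 = n ∧ 2 * i.val + 1 ≤ n) := by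
  simp only [isEccentric_iff_forall_dist_le, dist_pathGraph]
  refine ⟨fun h => ?_, fun h k => by omega⟩
  have hn := i.pos
  have h₀ := h ⟨0, hn⟩
  have h₁ := h ⟨n - 1, by omega⟩
  dsimp only at h₀ h₁
  omega

theorem eccGraph_grid_adj {m n : ℕ} (x y : Fin m × Fin n) :
    (eccGraph ((pathGraph m).boxProd (pathGraph n))).Adj x y ↔ x ≠ y ∧
      ((IsEccentric (pathGraph m) x.1 y.1 ∧ IsEccentric (pathGraph n) x.2 y.2) ∨
        (IsEccentric (pathGraph m) y.1 x.1 ∧ IsEccentric (pathGraph n) y.2 x.2)) := by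
  simp only [eccGraph, SimpleGraph.fromRel_adj,
    isEccentric_boxProd (pathGraph_preconnected m) (pathGraph_preconnected n)]

/-- A graph whose edges all join a vertex `u` to `f u` is acyclic if `f` is an involution on its
range. -/
theorem isAcyclic_of_adj_imp_eq_apply {V : Type*} {G : SimpleGraph V} (f : V → V)
    (hf : ∀ u, f (f (f u)) = f u) (hG : ∀ u v, G.Adj u v → v = f u ∨ u = f v) :
    G.IsAcyclic := by
  classical
  intro a c hc
  have exists_neighbors : ∀ u ∈ c.support, ∃ x ∈ c.support, ∃ y ∈ c.support,
      x ≠ y ∧ G.Adj u x ∧ G.Adj u y := by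
    intro u hu
    have hr := hc.rotate hu
    refine ⟨_, ?_, _, ?_, hr.snd_ne_penultimate, Walk.adj_snd hr.not_nil,
      (Walk.adj_penultimate hr.not_nil).symm⟩
    · exact (Walk.mem_support_rotate_iff c u hu).1 (Walk.getVert_mem_support _ _)
    · exact (Walk.mem_support_rotate_iff c u hu).1 (Walk.getVert_mem_support _ _)
  have mem_range : ∀ u ∈ c.support, f (f u) = u := by
    intro u hu
    obtain ⟨x, -, y, -, hxy, hx, hy⟩ := exists_neighbors u hu
    rcases hG u x hx with rfl | rfl
    · rcases hG u y hy with rfl | rfl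
      · exact absurd rfl hxy
      · exact hf y
    · exact hf x
  obtain ⟨x, hx, y, hy, hxy, hax, hay⟩ := exists_neighbors a c.start_mem_support
  have eq_apply : ∀ z ∈ c.support, G.Adj a z → z = f a := fun z hz haz =>
    (hG a z haz).elim id fun h => by rw [h, mem_range z hz]
  exact hxy ((eq_apply x hx hax).trans (eq_apply y hy hay).symm)

theorem IsEccentric.two_mul_lt_iff {n : ℕ} (hn : Even n) {i j : Fin n}
    (h : IsEccentric (pathGraph n) i j) : 2 * j.val < n ↔ ¬ 2 * i.val < n := by
  rw [isEccentric_pathGraph] at h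
  obtain ⟨k, rfl⟩ := hn
  omega

/-- The end of the path `pathGraph n` farthest from the vertex `i`. -/
def farEnd {n : ℕ} (i : Fin n) : Fin n :=
  if 2 * i.val < n then ⟨n - 1, Nat.sub_one_lt_of_lt i.pos⟩ else ⟨0, i.pos⟩

theorem val_farEnd {n : ℕ} (i : Fin n) :
    (farEnd i).val = if 2 * i.val < n then n - 1 else 0 := by
  unfold farEnd
  split_ifs <;> rfl

theorem farEnd_farEnd_farEnd {n : ℕ} (hn : 2 ≤ n) (i : Fin n) :
    farEnd (farEnd (farEnd i)) = farEnd i := by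
  ext
  simp only [val_farEnd]
  split_ifs <;> omega

theorem IsEccentric.eq_farEnd {n : ℕ} (hn : Even n) {i j : Fin n}
    (h : IsEccentric (pathGraph n) i j) : j = farEnd i := by
  rw [isEccentric_pathGraph] at h
  obtain ⟨k, rfl⟩ := hn
  ext
  rw [val_farEnd]
  split_ifs <;> omega

theorem isAcyclic_eccGraph_grid {m n : ℕ} (hm : 2 ≤ m) (hn : 2 ≤ n) (hm' : Even m)
    (hn' : Even n) : (eccGraph ((pathGraph m).boxProd (pathGraph n))).IsAcyclic := by
  refine isAcyclic_of_adj_imp_eq_apply (Prod.map farEnd farEnd) (fun u => ?_) (fun u v h => ?_)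
  · exact Prod.ext (farEnd_farEnd_farEnd hm u.1) (farEnd_farEnd_farEnd hn u.2)
  · rw [eccGraph_grid_adj] at h
    exact h.2.imp (fun h => Prod.ext (h.1.eq_farEnd hm') (h.2.eq_farEnd hn'))
      fun h => Prod.ext (h.1.eq_farEnd hm') (h.2.eq_farEnd hn')

theorem egirth_le_three_of_adj {V : Type*} {G : SimpleGraph V} {a b c : V} (hab : G.Adj a b)
    (hbc : G.Adj b c) (hca : G.Adj c a) : G.egirth ≤ 3 := by
  have hw : (Walk.cons hab (.cons hbc (.cons hca .nil))).IsCycle := by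
    simp [Walk.cons_isCycle_iff, hab.ne, hab.ne', hbc.ne, hca.ne, hca.ne']
  simpa using egirth_le_length hw

theorem egirth_le_four_of_adj {V : Type*} {G : SimpleGraph V} {a b c d : V} (hab : G.Adj a b)
    (hbc : G.Adj b c) (hcd : G.Adj c d) (hda : G.Adj d a) (hac : a ≠ c) (hbd : b ≠ d) :
    G.egirth ≤ 4 := by
  have hw : (Walk.cons hab (.cons hbc (.cons hcd (.cons hda .nil)))).IsCycle := by
    simp [Walk.cons_isCycle_iff, hab.ne, hab.ne', hbc.ne, hcd.ne, hda.ne, hda.ne', hac, hac.symm,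
      hbd]
  simpa using egirth_le_length hw

theorem SimpleGraph.Coloring.four_le_egirth {V : Type*} {G : SimpleGraph V}
    (C : G.Coloring Bool) : 4 ≤ G.egirth := by
  refine le_egirth.2 fun a w hw => ?_
  have h₃ := hw.three_le_length
  obtain ⟨k, hk⟩ := (C.even_length_iff_congr w).2 Iff.rfl
  exact_mod_cast (by omega : 4 ≤ w.length)

theorem egirth_eccGraph_grid_of_odd_of_odd {m n : ℕ} (hm : 2 ≤ m) (hn : 2 ≤ n) (hm' : Odd m)
    (hn' : Odd n) : (eccGraph ((pathGraph m).boxProd (pathGraph n))).egirth = 3 := by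
  obtain ⟨k, rfl⟩ := hm'
  obtain ⟨l, rfl⟩ := hn'
  refine le_antisymm ?_ three_le_egirth
  refine egirth_le_three_of_adj (a := (⟨k, by omega⟩, ⟨l, by omega⟩))
    (b := (⟨0, by omega⟩, ⟨0, by omega⟩)) (c := (⟨2 * k, by omega⟩, ⟨2 * l, by omega⟩)) ?_ ?_ ?_
  all_goals
    simp only [eccGraph_grid_adj, isEccentric_pathGraph, ne_eq, Prod.mk.injEq, Fin.mk.injEq,
      true_and]
    omega

theorem egirth_eccGraph_grid_of_even_of_odd {m n : ℕ} (hm : 4 ≤ m) (hn : 2 ≤ n) (hm' : Even m)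
    (hn' : Odd n) : (eccGraph ((pathGraph m).boxProd (pathGraph n))).egirth = 4 := by
  refine le_antisymm ?_ ?_
  · obtain ⟨l, rfl⟩ := hn'
    refine egirth_le_four_of_adj (a := (⟨0, by omega⟩, ⟨l, by omega⟩))
      (b := (⟨m - 1, by omega⟩, ⟨0, by omega⟩)) (c := (⟨1, by omega⟩, ⟨l, by omega⟩))
      (d := (⟨m - 1, by omega⟩, ⟨2 * l, by omega⟩)) ?_ ?_ ?_ ?_ ?_ ?_
    all_goals
      simp only [eccGraph_grid_adj, isEccentric_pathGraph, ne_eq, Prod.mk.injEq, Fin.mk.injEq,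
      true_and]
      omega
  · refine Coloring.four_le_egirth (Coloring.mk (fun x => decide (2 * x.1.val < m)) ?_)
    intro x y h
    rw [eccGraph_grid_adj] at h
    have h' := h.2.imp (fun h => h.1.two_mul_lt_iff hm') (fun h => h.1.two_mul_lt_iff hm')
    rw [ne_eq, decide_eq_decide]
    tauto

/-- Girth of the eccentric graph of the grid `P_m □ P_n`: acyclic when `m, n` both even,
girth 3 when both odd, girth 4 when `m` is even (`m ≥ 4`) and `n` is odd. -/
theorem stmt_14 (m n : ℕ) (hm : 2 ≤ m) (hn : 2 ≤ n) :
    (Even m → Even n → (eccGraph ((pathGraph m).boxProd (pathGraph n))).IsAcyclic) ∧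
    (Odd m → Odd n → (eccGraph ((pathGraph m).boxProd (pathGraph n))).egirth = 3) ∧
    (Even m → 4 ≤ m → Odd n →
      (eccGraph ((pathGraph m).boxProd (pathGraph n))).egirth = 4) := by
  exact ⟨isAcyclic_eccGraph_grid hm hn, egirth_eccGraph_grid_of_odd_of_odd hm hn,
    fun hm' hm₄ hn' => egirth_eccGraph_grid_of_even_of_odd hm₄ hn hm' hn'⟩
end

section
/- Let n ≥ 3 be odd. Then the eccentric graph E(C_n □ C_n) is isomorphic (as a simple graph) to C_n □ C_n itself. -/
open SimpleGraph

theorem Fin.val_sub_add_cases {n : ℕ} (u v : Fin n) :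
    (u - v).val + v.val = u.val ∨ (u - v).val + v.val = u.val + n := by
  rcases le_or_gt v u with h | h
  · have := Fin.coe_sub_iff_le.mpr h
    have : v.val ≤ u.val := h
    omega
  · have := Fin.coe_sub_iff_lt.mpr h
    have := v.isLt
    omega

namespace SimpleGraph

theorem dist_cycleGraph_le_val_sub {n : ℕ} (u v : Fin (n + 2)) :
    (cycleGraph (n + 2)).dist u v ≤ (v - u).val := by
  induction h : (v - u).val generalizing v with
  | zero =>
    have : v = u := by
      have := Fin.val_sub_add_cases v u
      have := v.isLt
      ext
      omega
    simp [this]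
  | succ k ih =>
    have hval : (v - 1 - u).val = k := by
      have h1 := Fin.val_sub_add_cases v 1
      have h2 := Fin.val_sub_add_cases (v - 1) u
      have h3 := Fin.val_sub_add_cases v u
      have := (v - 1).isLt
      have := (v - 1 - u).isLt
      have := (v - u).isLt
      have : (1 : Fin (n + 2)).val = 1 := rfl
      omega
    have hadj : (cycleGraph (n + 2)).Adj (v - 1) v := by
      simp [cycleGraph_adj]
    calc (cycleGraph (n + 2)).dist u v
        ≤ (cycleGraph (n + 2)).dist u (v - 1) + (cycleGraph (n + 2)).dist (v - 1) v :=
          cycleGraph_connected.dist_triangle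
      _ ≤ k + 1 := Nat.add_le_add (ih _ hval) (dist_eq_one_iff_adj.mpr hadj).le

theorem min_val_sub_le_length_cycleGraph {n : ℕ} {u v : Fin n} (p : (cycleGraph n).Walk u v) :
    min (v - u).val (u - v).val ≤ p.length := by
  induction p with
  | nil => simp [Fin.val_sub]
  | @cons u v w h p ih =>
    rw [cycleGraph_adj'] at h
    rw [Walk.length_cons]
    have h1 := Fin.val_sub_add_cases u v
    have h2 := Fin.val_sub_add_cases v u
    have h3 := Fin.val_sub_add_cases u w
    have h4 := Fin.val_sub_add_cases w u
    have h5 := Fin.val_sub_add_cases v w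
    have h6 := Fin.val_sub_add_cases w v
    have := u.isLt
    have := v.isLt
    have := w.isLt
    have := (u - w).isLt
    have := (w - u).isLt
    omega

theorem dist_cycleGraph {n : ℕ} (u v : Fin (n + 2)) :
    (cycleGraph (n + 2)).dist u v = min (v - u).val (u - v).val := by
  refine le_antisymm (le_min (dist_cycleGraph_le_val_sub u v) ?_) ?_
  · rw [dist_comm]
    exact dist_cycleGraph_le_val_sub v u
  · obtain ⟨p, hp⟩ := cycleGraph_connected.exists_walk_length_eq_dist u v
    exact hp ▸ min_val_sub_le_length_cycleGraph p

theorem Connected.dist_boxProd {α β : Type*} {G : SimpleGraph α} {H : SimpleGraph β}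
    (hG : G.Connected) (hH : H.Connected) (x y : α × β) :
    (G.boxProd H).dist x y = G.dist x.1 y.1 + H.dist x.2 y.2 := by
  have h := edist_boxProd (G := G) (H := H) x y
  rw [← (hG.boxProd hH x y).coe_dist_eq_edist, ← (hG x.1 y.1).coe_dist_eq_edist,
    ← (hH x.2 y.2).coe_dist_eq_edist] at h
  exact_mod_cast h

section OddCycle

open Fin.CommRing

theorem dist_cycleGraph_odd_le (m : ℕ) (u v : Fin (2 * m + 3)) :
    (cycleGraph (2 * m + 3)).dist u v ≤ m + 1 := by
  rw [dist_cycleGraph]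
  have := Fin.val_sub_add_cases u v
  have := Fin.val_sub_add_cases v u
  omega

theorem two_mul_natCast_half_add_one (m : ℕ) :
    2 * ((m + 1 : ℕ) : Fin (2 * m + 3)) + 1 = 0 := by
  have h : ((2 * m + 3 : ℕ) : Fin (2 * m + 3)) = 0 := Fin.natCast_self _
  push_cast at h ⊢
  linear_combination h

theorem dist_cycleGraph_odd_eq_iff (m : ℕ) (u v : Fin (2 * m + 3)) :
    (cycleGraph (2 * m + 3)).dist u v = m + 1 ↔
      v - u = ((m + 1 : ℕ) : Fin (2 * m + 3)) ∨ u - v = ((m + 1 : ℕ) : Fin (2 * m + 3)) := by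
  have hval : ((m + 1 : ℕ) : Fin (2 * m + 3)).val = m + 1 := Fin.val_cast_of_lt (by omega)
  rw [dist_cycleGraph, Fin.ext_iff, Fin.ext_iff, hval]
  have := Fin.val_sub_add_cases u v
  have := Fin.val_sub_add_cases v u
  omega

theorem ecc_boxProd_cycleGraph_odd (m : ℕ) (x : Fin (2 * m + 3) × Fin (2 * m + 3)) :
    ecc ((cycleGraph (2 * m + 3)).boxProd (cycleGraph (2 * m + 3))) x = 2 * (m + 1) := by
  apply le_antisymm
  · refine Finset.sup_le fun y _ ↦ ?_
    rw [cycleGraph_connected.dist_boxProd cycleGraph_connected]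
    linarith [dist_cycleGraph_odd_le m x.1 y.1, dist_cycleGraph_odd_le m x.2 y.2]
  · refine le_trans (le_of_eq ?_) (Finset.le_sup (Finset.mem_univ
      (x.1 + ((m + 1 : ℕ) : Fin (2 * m + 3)), x.2 + ((m + 1 : ℕ) : Fin (2 * m + 3)))))
    rw [cycleGraph_connected.dist_boxProd cycleGraph_connected,
      (dist_cycleGraph_odd_eq_iff m _ _).mpr (Or.inl (add_sub_cancel_left _ _)),
      (dist_cycleGraph_odd_eq_iff m _ _).mpr (Or.inl (add_sub_cancel_left _ _)), two_mul]

theorem isEccentric_boxProd_cycleGraph_odd (m : ℕ) (x y : Fin (2 * m + 3) × Fin (2 * m + 3)) :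
    IsEccentric ((cycleGraph (2 * m + 3)).boxProd (cycleGraph (2 * m + 3))) x y ↔
      (cycleGraph (2 * m + 3)).dist x.1 y.1 = m + 1 ∧
        (cycleGraph (2 * m + 3)).dist x.2 y.2 = m + 1 := by
  rw [IsEccentric, ecc_boxProd_cycleGraph_odd,
    Connected.dist_boxProd (G := cycleGraph (2 * m + 3)) (H := cycleGraph (2 * m + 3))
      cycleGraph_connected cycleGraph_connected]
  have := dist_cycleGraph_odd_le m x.1 y.1
  have := dist_cycleGraph_odd_le m x.2 y.2
  omega

theorem eccGraph_boxProd_cycleGraph_odd_adj (m : ℕ) (x y : Fin (2 * m + 3) × Fin (2 * m + 3)) :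
    (eccGraph ((cycleGraph (2 * m + 3)).boxProd (cycleGraph (2 * m + 3)))).Adj x y ↔
      (cycleGraph (2 * m + 3)).dist x.1 y.1 = m + 1 ∧
        (cycleGraph (2 * m + 3)).dist x.2 y.2 = m + 1 := by
  rw [eccGraph, fromRel_adj, isEccentric_boxProd_cycleGraph_odd,
    isEccentric_boxProd_cycleGraph_odd, dist_comm (u := y.1), dist_comm (u := y.2), or_self,
    and_iff_right_iff_imp]
  rintro ⟨h, -⟩ rfl
  simp at h

/-- The map `(a, b) ↦ (a + b, a - b)`, invertible when `2 * c = -1`. -/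
def sumDiffEquiv {R : Type*} [CommRing R] (c : R) (hc : 2 * c + 1 = 0) : R × R ≃ R × R where
  toFun x := (x.1 + x.2, x.1 - x.2)
  invFun x := (-c * (x.1 + x.2), -c * (x.1 - x.2))
  left_inv x := by
    ext
    · linear_combination (-x.1) * hc
    · linear_combination (-x.2) * hc
  right_inv x := by
    ext
    · linear_combination (-x.1) * hc
    · linear_combination (-x.2) * hc

theorem sum_diff_eq_iff {R : Type*} [CommRing R] {c : R} (hc : 2 * c + 1 = 0) (a b a' b' : R) :
    ((a + b - (a' + b') = 1 ∨ a' + b' - (a + b) = 1) ∧ a - b = a' - b' ∨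
      (a - b - (a' - b') = 1 ∨ a' - b' - (a - b) = 1) ∧ a + b = a' + b') ↔
    (a' - a = c ∨ a - a' = c) ∧ (b' - b = c ∨ b - b' = c) := by
  constructor
  · rintro (⟨h | h, h'⟩ | ⟨h | h, h'⟩)
    · exact ⟨Or.inl (by linear_combination (a' - a) * hc + c * h + c * h'),
        Or.inl (by linear_combination (b' - b) * hc + c * h - c * h')⟩
    · exact ⟨Or.inr (by linear_combination (a - a') * hc + c * h - c * h'),
        Or.inr (by linear_combination (b - b') * hc + c * h + c * h')⟩
    · exact ⟨Or.inl (by linear_combination (a' - a) * hc + c * h + c * h'),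
        Or.inr (by linear_combination (b - b') * hc + c * h - c * h')⟩
    · exact ⟨Or.inr (by linear_combination (a - a') * hc + c * h - c * h'),
        Or.inl (by linear_combination (b' - b) * hc + c * h + c * h')⟩
  · rintro ⟨h | h, h' | h'⟩
    · exact Or.inl ⟨Or.inl (by linear_combination -hc - h - h'), by linear_combination h' - h⟩
    · exact Or.inr ⟨Or.inl (by linear_combination -hc - h - h'), by linear_combination h' - h⟩
    · exact Or.inr ⟨Or.inr (by linear_combination -hc - h - h'), by linear_combination h - h'⟩
    · exact Or.inl ⟨Or.inr (by linear_combination -hc - h - h'), by linear_combination h - h'⟩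

/-- `(a, b) ↦ (a + b, a - b)` is an isomorphism from the eccentric graph of the square of an odd
cycle to that square. -/
noncomputable def eccGraphBoxProdCycleGraphOddIso (m : ℕ) :
    eccGraph ((cycleGraph (2 * m + 3)).boxProd (cycleGraph (2 * m + 3))) ≃g
      (cycleGraph (2 * m + 3)).boxProd (cycleGraph (2 * m + 3)) where
  toEquiv := sumDiffEquiv _ (two_mul_natCast_half_add_one m)
  map_rel_iff' {x y} := by
    rw [eccGraph_boxProd_cycleGraph_odd_adj, dist_cycleGraph_odd_eq_iff,
      dist_cycleGraph_odd_eq_iff, boxProd_adj, cycleGraph_adj, cycleGraph_adj]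
    exact sum_diff_eq_iff (two_mul_natCast_half_add_one m) _ _ _ _

end OddCycle

end SimpleGraph

/-- For odd `n ≥ 3`, the eccentric graph of `C_n □ C_n` is isomorphic to `C_n □ C_n`. -/
theorem stmt_17 (n : ℕ) (hn3 : 3 ≤ n) (hnodd : Odd n) :
    Nonempty ((eccGraph ((cycleGraph n).boxProd (cycleGraph n))) ≃g
      ((cycleGraph n).boxProd (cycleGraph n))) := by
  obtain ⟨k, rfl⟩ := hnodd
  obtain ⟨m, rfl⟩ : ∃ m, k = m + 1 := ⟨k - 1, by omega⟩
  exact ⟨eccGraphBoxProdCycleGraphOddIso m⟩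
end
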